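/- Let n ≥ 5 be an integer with n ≡ 5 (mod 6), let λ ≥ 1 be a real number, and let p : ZMod n → ℂ satisfy 1 ≤ ‖p j‖ ≤ λ and 1 ≤ ‖p j - p (j-1)‖ ≤ λ for every j ∈ ZMod n. Then λ ≥ 2·sin((π/6)·((n+1)/n)). -/

import Mathlib

open Real

/-- In a triangle with vertices `0`, `z`, `w` whose side lengths all lie in `[1, l]`, the angle `x`
at `0` satisfies `l⁻¹ ≤ 2 * sin (x / 2) ≤ l`, provided `l` is at most the golden ratio. -/
lemma two_mul_sin_half_angle_bounds {l : ℝ} (hl : 1 ≤ l) (hl' : l * (l - 1) ≤ 1) {z w : ℂ}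
    (hz : 1 ≤ ‖z‖) (hzl : ‖z‖ ≤ l) (hw : 1 ≤ ‖w‖) (hwl : ‖w‖ ≤ l)
    (hd : 1 ≤ ‖z - w‖) (hdl : ‖z - w‖ ≤ l) :
    2 * sin (InnerProductGeometry.angle z w / 2) ≤ l ∧
      1 ≤ 2 * l * sin (InnerProductGeometry.angle z w / 2) := by
  have key :=
    InnerProductGeometry.norm_sub_sq_eq_norm_sq_add_norm_sq_sub_two_mul_norm_mul_norm_mul_cos_angle
      z w
  set x := InnerProductGeometry.angle z w
  have hcos : cos x = 1 - 2 * sin (x / 2) ^ 2 := by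
    have h := cos_sq_add_sin_sq (x / 2)
    have h2 := cos_two_mul (x / 2)
    rw [mul_div_cancel₀ x two_ne_zero] at h2
    linarith
  have hs : 0 ≤ sin (x / 2) :=
    sin_nonneg_of_nonneg_of_le_pi (by linarith [InnerProductGeometry.angle_nonneg z w])
      (by linarith [InnerProductGeometry.angle_le_pi z w, InnerProductGeometry.angle_nonneg z w])
  rw [hcos] at key
  generalize sin (x / 2) = s at *
  generalize ‖z‖ = a at *
  generalize ‖w‖ = b at *
  generalize ‖z - w‖ = c at *
  have hab : 1 ≤ a * b := by nlinarith
  have key' : 4 * (a * b) * s ^ 2 = c ^ 2 - (a - b) ^ 2 := by linarith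
  constructor
  · refine (sq_le_sq₀ (by linarith) (by linarith)).1 ?_
    nlinarith [sq_nonneg (a - b), mul_nonneg (sub_nonneg.2 hab) (sq_nonneg s)]
  · have aux : ∀ u v : ℝ, 1 ≤ u → u ≤ v → v ≤ l → l ^ 2 * (v - u) ^ 2 + u * v ≤ l ^ 2 := by
      intro u v hu huv hv
      have h1 : l * (v - u) ≤ 1 := by nlinarith
      have h2 : 0 ≤ l * (v - u) := mul_nonneg (by linarith) (by linarith)
      have h3 : (l * (v - u)) ^ 2 ≤ l * (v - u) := by nlinarith
      nlinarith [mul_nonneg (sub_nonneg.2 hv) (by linarith : 0 ≤ l + u)]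
    have h : l ^ 2 * (a - b) ^ 2 + a * b ≤ l ^ 2 := by
      rcases le_total a b with h | h
      · nlinarith [aux a b hz h hwl]
      · nlinarith [aux b a hw h hzl]
    have h1 : a * b * 1 ≤ a * b * (2 * l * s) ^ 2 := by
      have : l ^ 2 * 1 ≤ l ^ 2 * c ^ 2 := by gcongr; nlinarith
      have e : a * b * (2 * l * s) ^ 2 = l ^ 2 * (4 * (a * b) * s ^ 2) := by ring
      rw [e, key']
      linarith
    have h2 := le_of_mul_le_mul_left h1 (by linarith)
    exact (one_le_sq_iff₀ (by positivity)).1 h2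

/-- The arguments of the successive quotients of a closed sequence add up to a multiple of `2π`. -/
lemma exists_sum_arg_div_eq {n : ℕ} [NeZero n] (p : ZMod n → ℂ) (hp : ∀ j, p j ≠ 0) :
    ∃ m : ℤ, ∑ j, Complex.arg (p j / p (j - 1)) = m * (2 * π) := by
  have hprod : ∏ j, p j / p (j - 1) = 1 := by
    have h : ∏ j, p (j - 1) = ∏ j, p j := (Equiv.subRight (1 : ZMod n)).prod_comp p
    rw [Finset.prod_div_distrib, h, div_self (Finset.prod_ne_zero_iff.2 fun j _ => hp j)]
  have hnorm : ∏ j, ‖p j / p (j - 1)‖ = 1 := by rw [← norm_prod, hprod, norm_one]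
  have hexp : Complex.exp (∑ j, Complex.arg (p j / p (j - 1)) * Complex.I) = 1 := by
    have hnorm' : ∏ j, (‖p j / p (j - 1)‖ : ℂ) = 1 := by exact_mod_cast hnorm
    rw [Complex.exp_sum, ← one_mul (∏ j, _), ← hnorm', ← Finset.prod_mul_distrib]
    simp only [Complex.norm_mul_exp_arg_mul_I, hprod, hnorm']
  obtain ⟨m, hm⟩ := Complex.exp_eq_one_iff.1 hexp
  refine ⟨m, ?_⟩
  rw [← Finset.sum_mul, ← mul_assoc, ← mul_assoc] at hm
  have := mul_right_cancel₀ Complex.I_ne_zero hm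
  rw [← mul_assoc]
  exact_mod_cast this

/-- An odd number of reals, each within `π / (3n)` of `π / 3` in absolute value, does not add up
to a multiple of `2π`. -/
lemma sum_ne_of_abs_near_pi_div_three {ι : Type*} [Fintype ι] [Nonempty ι]
    (hodd : Odd (Fintype.card ι)) (f : ι → ℝ)
    (hf : ∀ j, |(|f j| - π / 3)| < π / (3 * Fintype.card ι)) (m : ℤ) :
    ∑ j, f j ≠ m * (2 * π) := by
  intro hm
  have ht : ∀ j, ∃ t : ℤ, |f j - (1 - 2 * t) * (π / 3)| < π / (3 * Fintype.card ι) := by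
    intro j
    rcases abs_cases (f j) with ⟨h, -⟩ | ⟨h, -⟩
    · refine ⟨0, ?_⟩
      have := hf j
      rw [h] at this
      simpa using this
    · refine ⟨1, ?_⟩
      have := hf j
      rw [h, ← abs_neg] at this
      convert this using 2
      push_cast
      ring
  choose t ht using ht
  have hcard : (0 : ℝ) < Fintype.card ι := by exact_mod_cast Fintype.card_pos
  have hlt : |∑ j, (f j - (1 - 2 * t j) * (π / 3))| < π / 3 := by
    calc _ ≤ ∑ j, |f j - (1 - 2 * t j) * (π / 3)| := Finset.abs_sum_le_sum_abs _ _
      _ < ∑ _j : ι, π / (3 * Fintype.card ι) :=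
        Finset.sum_lt_sum_of_nonempty Finset.univ_nonempty fun j _ => ht j
      _ = π / 3 := by
        rw [Finset.sum_const, Finset.card_univ, nsmul_eq_mul]
        field_simp
  have heq : ∑ j, (f j - (1 - 2 * t j) * (π / 3)) =
      ((6 * m - Fintype.card ι + 2 * ∑ j, t j : ℤ) : ℝ) * (π / 3) := by
    rw [Finset.sum_sub_distrib, hm, ← Finset.sum_mul, Finset.sum_sub_distrib, ← Finset.mul_sum]
    simp only [Finset.sum_const, Finset.card_univ, nsmul_eq_mul]
    push_cast
    ring
  rw [heq, abs_mul, abs_of_pos (by positivity : 0 < π / 3)] at hlt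
  have h1 : |((6 * m - Fintype.card ι + 2 * ∑ j, t j : ℤ) : ℝ)| < 1 := by
    by_contra! h
    nlinarith [pi_pos]
  have h2 : |6 * m - Fintype.card ι + 2 * ∑ j, t j| < 1 := by exact_mod_cast h1
  rw [Int.abs_lt_one_iff] at h2
  obtain ⟨k, hk⟩ := hodd
  omega

theorem wheel_mod_five_lower_bound (n : ℕ) (hn : 5 ≤ n) (hmod : n % 6 = 5)
    (l : ℝ) (hl : 1 ≤ l) (p : ZMod n → ℂ)
    (hp : ∀ j : ZMod n,
      1 ≤ ‖p j‖ ∧ ‖p j‖ ≤ l ∧ 1 ≤ ‖p j - p (j - 1)‖ ∧ ‖p j - p (j - 1)‖ ≤ l) :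
    2 * Real.sin (Real.pi / 6 * (((n : ℝ) + 1) / (n : ℝ))) ≤ l := by
  have : NeZero n := ⟨by omega⟩
  have hn' : (5 : ℝ) ≤ n := by exact_mod_cast hn
  have hpi := pi_pos
  by_contra! hlt
  obtain ⟨μ, hμ⟩ : ∃ μ : ℝ, μ = π / (3 * n) := ⟨_, rfl⟩
  have hμ0 : 0 < μ := by rw [hμ]; positivity
  have hμ1 : μ ≤ π / 6 := by rw [hμ]; gcongr; linarith
  have harg : π / 6 * (((n : ℝ) + 1) / n) = π / 6 + μ / 2 := by rw [hμ]; field_simp; ring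
  rw [harg] at hlt
  have hl2 : l ^ 2 < 2 := by
    have h : sin (π / 6 + μ / 2) ≤ √2 / 2 := by
      rw [← sin_pi_div_four]
      exact sin_le_sin_of_le_of_le_pi_div_two (by linarith) (by linarith) (by linarith)
    have h2 : l < √2 := by linarith
    nlinarith [sq_sqrt (zero_le_two (α := ℝ))]
  have hne : ∀ j, p j ≠ 0 := fun j => norm_pos_iff.1 (by linarith [(hp j).1])
  obtain ⟨m, hm⟩ := exists_sum_arg_div_eq p hne
  refine sum_ne_of_abs_near_pi_div_three (by rw [ZMod.card, Nat.odd_iff]; omega) _ (fun j => ?_)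
    m hm
  rw [ZMod.card, ← hμ, ← Complex.angle_eq_abs_arg (hne j) (hne (j - 1))]
  obtain ⟨hs, hs'⟩ := two_mul_sin_half_angle_bounds hl (by nlinarith) (hp j).1 (hp j).2.1
    (hp (j - 1)).1 (hp (j - 1)).2.1 (hp j).2.2.1 (hp j).2.2.2
  have hx0 := InnerProductGeometry.angle_nonneg (p j) (p (j - 1))
  have hxpi := InnerProductGeometry.angle_le_pi (p j) (p (j - 1))
  generalize InnerProductGeometry.angle (p j) (p (j - 1)) = x at *
  have hprod : 4 * (sin (π / 6 + μ / 2) * sin (π / 6 - μ / 2)) ≤ 1 := by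
    have h1 := cos_sub (π / 6 + μ / 2) (π / 6 - μ / 2)
    have h2 := cos_add (π / 6 + μ / 2) (π / 6 - μ / 2)
    rw [show π / 6 + μ / 2 + (π / 6 - μ / 2) = π / 3 by ring, cos_pi_div_three] at h2
    linarith [cos_le_one (π / 6 + μ / 2 - (π / 6 - μ / 2))]
  rw [abs_lt]
  constructor
  · by_contra! h
    have : sin (x / 2) ≤ sin (π / 6 - μ / 2) :=
      sin_le_sin_of_le_of_le_pi_div_two (by linarith) (by linarith) (by linarith)
    have hpos : 0 < sin (x / 2) := pos_of_mul_pos_right (by linarith) (by linarith : 0 ≤ 2 * l)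
    nlinarith [mul_le_mul_of_nonneg_left this (by linarith : 0 ≤ 2 * l),
      mul_pos (sub_pos.2 hlt) (hpos.trans_le this)]
  · by_contra! h
    have : sin (π / 6 + μ / 2) ≤ sin (x / 2) :=
      sin_le_sin_of_le_of_le_pi_div_two (by linarith) (by linarith) (by linarith)
    linarith
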